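/- Fix n ≥ 1 and multisegments m, m′, m″ (families of nonnegative integers indexed by intervals [a,b] with 1 ≤ a ≤ b ≤ n) with dimension vectors d, d′, d″ satisfying d = d′ + d″. Then there exists a polynomial P ∈ ℤ[T] such that for every finite field k with q elements and every representation φ ∈ E(d) of Δ_n over k of type m, the number of graded subspaces W = ⊕_i W_i ⊆ ⊕_i k^{d_i} with φ_i(W_i) ⊆ W_{i+1} for all i, such that the subrepresentation (W, φ|_W) has type m′ and the quotient representation on ⊕_i k^{d_i}/W_i has type m″, is equal to P(q). (Existence of Hall polynomials for Δ_n.) -/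

import Mathlib

open Module LinearMap Finset

/-- The composition `φ_{i+t-1} ∘ ⋯ ∘ φ_{i+1} ∘ φ_i` of `t` consecutive structure
maps of a representation of an equioriented quiver of type `A`, starting at
vertex `i`. -/
def comps {k : Type*} [Field k] {V : ℕ → Type*}
    [∀ i, AddCommGroup (V i)] [∀ i, Module k (V i)]
    (φ : ∀ i : ℕ, V i →ₗ[k] V (i + 1)) (i : ℕ) : ∀ t : ℕ, V i →ₗ[k] V (i + t)
  | 0 => LinearMap.id
  | t + 1 => (φ (i + t)).comp (comps φ i t)

/-- The dimension vector of a multisegment `m = (m_{a,b})_{1 ≤ a ≤ b ≤ n}`: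
`dᵢ = Σ_{a ≤ i ≤ b} m_{a,b}` (zero outside the vertex range `1, …, n`). -/
def dimOf (n : ℕ) (m : ℕ → ℕ → ℕ) (i : ℕ) : ℕ :=
  ∑ a ∈ Icc 1 i, ∑ b ∈ Icc i n, m a b

/-- A representation of the equioriented quiver `Δ_n` on the graded space
`(V i)` has type the multisegment `m`: its graded dimensions are those of `m`
and `rank(φ_j ∘ ⋯ ∘ φ_i) = Σ_{a ≤ i, j+1 ≤ b} m_{a,b}` for all
`1 ≤ i ≤ j ≤ n-1`. -/
def HasTypeA (k : Type*) [Field k] (n : ℕ) (m : ℕ → ℕ → ℕ) {V : ℕ → Type*}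
    [∀ i, AddCommGroup (V i)] [∀ i, Module k (V i)]
    (φ : ∀ i : ℕ, V i →ₗ[k] V (i + 1)) : Prop :=
  (∀ i : ℕ, finrank k (V i) = dimOf n m i) ∧
  ∀ i j : ℕ, 1 ≤ i → i ≤ j → j ≤ n - 1 →
    finrank k (LinearMap.range (comps φ i (j - i + 1)))
      = ∑ a ∈ Icc 1 i, ∑ b ∈ Icc (j + 1) n, m a b

section Transition

variable {k : Type*} [Field k] {V : ℕ → Type*} [∀ i, AddCommGroup (V i)] [∀ i, Module k (V i)]

/-- The identity map between two equal vertices. -/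
def vertexCast (k : Type*) [Field k] (V : ℕ → Type*) [∀ i, AddCommGroup (V i)]
    [∀ i, Module k (V i)] {i j : ℕ} (h : i = j) : V i →ₗ[k] V j := by
  subst h
  exact LinearMap.id

/-- The structure map `V i → V j` of a representation for `i ≤ j` (zero for `j < i`). -/
def transition (φ : ∀ i : ℕ, V i →ₗ[k] V (i + 1)) (i : ℕ) : ∀ j : ℕ, V i →ₗ[k] V j
  | 0 => if h : i = 0 then vertexCast k V h else 0
  | j + 1 =>
    if i ≤ j then (φ j).comp (transition φ i j)
    else if h : i = j + 1 then vertexCast k V h else 0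

variable (φ : ∀ i : ℕ, V i →ₗ[k] V (i + 1))

@[simp]
theorem transition_self (i : ℕ) : transition φ i i = LinearMap.id := by
  cases i <;> simp [transition, vertexCast]

theorem transition_succ {i j : ℕ} (h : i ≤ j) :
    transition φ i (j + 1) = (φ j).comp (transition φ i j) := by
  simp [transition, h]

theorem transition_comp {i j l : ℕ} (hij : i ≤ j) (hjl : j ≤ l) :
    (transition φ j l).comp (transition φ i j) = transition φ i l := by
  induction l, hjl using Nat.le_induction with
  | base => simp
  | succ l hl ih => rw [transition_succ φ hl, transition_succ φ (hij.trans hl), comp_assoc, ih]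

theorem transition_apply {i j l : ℕ} (hij : i ≤ j) (hjl : j ≤ l) (x : V i) :
    transition φ j l (transition φ i j x) = transition φ i l x := by
  rw [← transition_comp φ hij hjl, comp_apply]

theorem comps_eq_transition (i t : ℕ) : comps φ i t = transition φ i (i + t) := by
  induction t with
  | zero => exact (transition_self φ i).symm
  | succ t ih =>
    rw [comps, ih]
    exact (transition_succ φ (Nat.le_add_right i t)).symm

/-- A graded subspace is a subrepresentation if it is stable under all structure maps. -/
def IsSubrep (W : ∀ i, Submodule k (V i)) : Prop :=
  ∀ i j, i ≤ j → (W i).map (transition φ i j) ≤ W j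

theorem isSubrep_iff {W : ∀ i, Submodule k (V i)} :
    IsSubrep φ W ↔ ∀ i, W i ≤ (W (i + 1)).comap (φ i) := by
  constructor
  · intro h i
    have := h i (i + 1) (Nat.le_succ i)
    rw [transition_succ φ le_rfl, transition_self, comp_id] at this
    exact Submodule.map_le_iff_le_comap.mp this
  · intro h i j hij
    induction j, hij using Nat.le_induction with
    | base => simp
    | succ j hj ih =>
      rw [transition_succ φ hj, Submodule.map_comp]
      exact (Submodule.map_mono ih).trans (Submodule.map_le_iff_le_comap.mpr (h j))

/-- The subquotient `A / B` has rank function `R`: the rank of `(A / B) i → (A / B) j`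
is `R i j` for all `i ≤ j`. -/
def HasRank (A B : ∀ i, Submodule k (V i)) (R : ℕ → ℕ → ℕ) : Prop :=
  ∀ i j, i ≤ j →
    finrank k ↥((A i).map (transition φ i j) ⊔ B j) = R i j + finrank k (B j)

variable {φ}

theorem HasRank.finrank_eq {A B : ∀ i, Submodule k (V i)} {R : ℕ → ℕ → ℕ}
    (h : HasRank φ A B R) (hBA : B ≤ A) (i : ℕ) :
    finrank k (A i) = R i i + finrank k (B i) := by
  have := h i i le_rfl
  rwa [transition_self, Submodule.map_id, sup_eq_left.mpr (hBA i)] at this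

theorem hasRank_bot_iff {A : ∀ i, Submodule k (V i)} {R : ℕ → ℕ → ℕ} :
    HasRank φ A ⊥ R ↔ ∀ i j, i ≤ j → finrank k ((A i).map (transition φ i j)) = R i j := by
  refine forall₃_congr fun i j _ => ?_
  rw [show (⊥ : ∀ i, Submodule k (V i)) j = ⊥ from rfl, sup_bot_eq, finrank_bot, add_zero]

end Transition

section Count

variable {k : Type*} [Field k] {V : Type*} [AddCommGroup V] [Module k V]

theorem Submodule.finrank_map_add_finrank_inf_ker [FiniteDimensional k V] {U : Type*}
    [AddCommGroup U] [Module k U] (Z : Submodule k V) (g : V →ₗ[k] U) :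
    finrank k (Z.map g) + finrank k ↥(Z ⊓ ker g) = finrank k Z := by
  have h := (g.domRestrict Z).finrank_range_add_finrank_ker
  rw [range_domRestrict, ker_domRestrict] at h
  rw [← h, inf_comm, ← Submodule.finrank_map_subtype_eq, Submodule.map_comap_subtype, inf_comm]

/-- Subspaces of codimension one in `Z`. -/
def IsHyperplane (H Z : Submodule k V) : Prop :=
  H ≤ Z ∧ finrank k H + 1 = finrank k Z

theorem IsHyperplane.sup_eq [FiniteDimensional k V] {H Z D : Submodule k V}
    (h : IsHyperplane H Z) (hD : D ≤ Z) (hDH : ¬ D ≤ H) : D ⊔ H = Z := by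
  apply Submodule.eq_of_le_of_finrank_le (sup_le hD h.1)
  have : H < D ⊔ H := lt_of_le_of_ne le_sup_right fun e => hDH (e ▸ le_sup_left)
  have := Submodule.finrank_lt_finrank_of_lt this
  have := h.2
  omega

theorem IsHyperplane.inf_comap [FiniteDimensional k V] {U : Type*} [AddCommGroup U] [Module k U]
    [FiniteDimensional k U] {H Z : Submodule k U} (h : IsHyperplane H Z) {Y : Submodule k V}
    {g : V →ₗ[k] U} (hY : Y.map g ≤ Z) (hYH : ¬ Y.map g ≤ H) :
    IsHyperplane (Y ⊓ H.comap g) Y := by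
  refine ⟨inf_le_left, ?_⟩
  have h1 := Submodule.finrank_map_add_finrank_inf_ker Y g
  have h2 := Submodule.finrank_map_add_finrank_inf_ker (Y ⊓ H.comap g) g
  have h3 : (Y ⊓ H.comap g) ⊓ ker g = Y ⊓ ker g := by
    have : ker g ≤ H.comap g := Submodule.comap_mono bot_le
    rw [inf_assoc, inf_eq_right.mpr this]
  rw [h3, ← Submodule.map_inf_eq_map_inf_comap] at h2
  have h4 := Submodule.finrank_sup_add_finrank_inf_eq (Y.map g) H
  rw [h.sup_eq hY hYH] at h4
  have := h.2
  omega

theorem IsHyperplane.finrank_map_of_le [FiniteDimensional k V] {U : Type*} [AddCommGroup U]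
    [Module k U] {Y Z : Submodule k V} (h : IsHyperplane Y Z) {g : V →ₗ[k] U}
    (hg : Z ⊓ ker g ≤ Y) : finrank k (Y.map g) = finrank k (Z.map g) - 1 := by
  have h1 := Y.finrank_map_add_finrank_inf_ker g
  have h2 := Z.finrank_map_add_finrank_inf_ker g
  have h3 : Y ⊓ ker g = Z ⊓ ker g :=
    le_antisymm (inf_le_inf_right _ h.1) (le_inf hg inf_le_right)
  rw [h3] at h1
  have := h.2
  omega

theorem IsHyperplane.map_eq_of_not_le [FiniteDimensional k V] {U : Type*} [AddCommGroup U]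
    [Module k U] {Y Z : Submodule k V} (h : IsHyperplane Y Z) {g : V →ₗ[k] U}
    (hg : ¬ Z ⊓ ker g ≤ Y) : Y.map g = Z.map g := by
  conv_rhs => rw [← h.sup_eq inf_le_left hg]
  rw [Submodule.map_sup, eq_comm, sup_eq_right, Submodule.map_le_iff_le_comap]
  exact inf_le_right.trans (Submodule.comap_mono bot_le)

theorem ncard_isHyperplane [FiniteDimensional k V] [Finite k] {D Z : Submodule k V}
    (hD : D ≤ Z) :
    {H : Submodule k V | D ≤ H ∧ IsHyperplane H Z}.ncard
      = ∑ i ∈ range (finrank k Z - finrank k D), Nat.card k ^ i := by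
  set N := (D.comap Z.subtype).dualAnnihilator with hN
  have hDf : finrank k (D.comap Z.subtype) = finrank k D :=
    (Submodule.comapSubtypeEquivOfLe hD).finrank_eq
  have hNf : finrank k N = finrank k Z - finrank k D := by
    have : finrank k (D.comap Z.subtype) + finrank k N = finrank k Z :=
      Subspace.finrank_add_finrank_dualAnnihilator_eq (D.comap Z.subtype)
    omega
  rw [← Projectivization.card_of_finrank k N hNf,
    Nat.card_congr (Projectivization.equivSubmodule k N)]
  symm
  change {L : Submodule k N | finrank k L = 1}.ncard = _
  let F : Submodule k N → Submodule k V := fun L =>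
    ((L.map N.subtype).dualCoannihilator).map Z.subtype
  have hF : ∀ L : Submodule k N, finrank k L + finrank k (F L) = finrank k Z := by
    intro L
    have := Subspace.finrank_add_finrank_dualCoannihilator_eq (L.map N.subtype)
    rwa [Submodule.finrank_map_subtype_eq, ← Submodule.finrank_map_subtype_eq Z] at this
  refine Set.BijOn.ncard_eq (f := F) ⟨?_, ?_, ?_⟩
  · intro L hL
    refine ⟨?_, Submodule.map_subtype_le _ _, ?_⟩
    · have : D = (D.comap Z.subtype).map Z.subtype := by
        rw [Submodule.map_comap_subtype, inf_eq_right.mpr hD]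
      rw [this]
      apply Submodule.map_mono
      rw [← Submodule.le_dualAnnihilator_iff_le_dualCoannihilator]
      exact Submodule.map_subtype_le _ _
    · have := hF L
      rw [Set.mem_ofPred_eq] at hL
      omega
  · intro L _ L' _ h
    have h1 := Submodule.map_injective_of_injective Z.injective_subtype h
    have h2 := congrArg Submodule.dualAnnihilator h1
    rw [Subspace.dualCoannihilator_dualAnnihilator_eq,
      Subspace.dualCoannihilator_dualAnnihilator_eq] at h2
    exact Submodule.map_injective_of_injective N.injective_subtype h2
  · rintro H ⟨hDH, hH⟩
    have hle : (H.comap Z.subtype).dualAnnihilator ≤ N :=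
      Submodule.dualAnnihilator_anti (Submodule.comap_mono hDH)
    have hFH : F ((H.comap Z.subtype).dualAnnihilator.comap N.subtype) = H := by
      simp only [F]
      rw [Submodule.map_comap_subtype, inf_eq_right.mpr hle,
        Subspace.dualAnnihilator_dualCoannihilator_eq, Submodule.map_comap_subtype,
        inf_eq_right.mpr hH.1]
    refine ⟨_, ?_, hFH⟩
    have := hF ((H.comap Z.subtype).dualAnnihilator.comap N.subtype)
    rw [hFH] at this
    have := hH.2
    rw [Set.mem_ofPred_eq]
    omega

/-- For two flags `A` and `B`, the dimension of a sum of intersections `A i ⊓ B j` is determined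
by the dimensions of these intersections. -/
theorem exists_finrank_iSup_inf (c : ℕ → ℕ → ℕ) (s : Finset (ℕ × ℕ)) :
    ∃ r : ℕ, ∀ (k : Type) [Field k] (V : Type) [AddCommGroup V] [Module k V]
      [FiniteDimensional k V] (A B : ℕ → Submodule k V), Monotone A → Monotone B →
      (∀ i j, finrank k ↥(A i ⊓ B j) = c i j) →
      finrank k ↥(s.sup fun e => A e.1 ⊓ B e.2) = r := by
  classical
  refine Finset.induction_on_min_value Prod.snd s ⟨0, by intros; simp⟩ ?_
  · intro e s _ hmin ih
    obtain ⟨r, hr⟩ := ih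
    rcases s.eq_empty_or_nonempty with rfl | hs
    · refine ⟨c e.1 e.2, ?_⟩
      intro k _ V _ _ _ A B _ _ hc
      rw [insert_empty_eq, Finset.sup_singleton, hc]
    obtain ⟨e', he', hmax⟩ := s.exists_max_image Prod.fst hs
    refine ⟨c e.1 e.2 + r - c (min e'.1 e.1) e.2, ?_⟩
    intro k _ V _ _ _ A B hA hB hc
    have hinf : (A e.1 ⊓ B e.2) ⊓ (s.sup fun e => A e.1 ⊓ B e.2) = A (min e'.1 e.1) ⊓ B e.2 := by
      apply le_antisymm
      · have hle : (s.sup fun e => A e.1 ⊓ B e.2) ≤ A e'.1 :=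
          Finset.sup_le fun x hx => inf_le_left.trans (hA (hmax x hx))
        refine le_inf ?_ (inf_le_left.trans inf_le_right)
        rcases min_choice e'.1 e.1 with h | h <;> rw [h]
        · exact inf_le_right.trans hle
        · exact inf_le_left.trans inf_le_left
      · refine le_inf (inf_le_inf_right _ (hA (min_le_right _ _))) ?_
        exact (inf_le_inf (hA (min_le_left _ _)) (hB (hmin e' he'))).trans
          (Finset.le_sup (f := fun e => A e.1 ⊓ B e.2) he')
    have := Submodule.finrank_sup_add_finrank_inf_eq (A e.1 ⊓ B e.2)
      (s.sup fun e => A e.1 ⊓ B e.2)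
    rw [hinf, hc, hc, hr k V A B hA hB hc] at this
    rw [Finset.sup_insert]
    omega

open Polynomial in
theorem exists_polynomial_ncard_isHyperplane (c : ℕ → ℕ → ℕ) (z : ℕ) (s t : Finset (ℕ × ℕ)) :
    ∃ P : ℤ[X], ∀ (k : Type) [Field k] [Finite k] (V : Type) [AddCommGroup V] [Module k V]
      [FiniteDimensional k V] (A B : ℕ → Submodule k V) (Z : Submodule k V),
      Monotone A → Monotone B → (∀ i j, finrank k ↥(A i ⊓ B j) = c i j) → (∀ i, A i ≤ Z) →
      finrank k Z = z →
      ({H : Submodule k V | IsHyperplane H Z ∧ (∀ e ∈ s, A e.1 ⊓ B e.2 ≤ H) ∧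
        ∀ e ∈ t, ¬ A e.1 ⊓ B e.2 ≤ H}.ncard : ℤ) = P.eval (Nat.card k : ℤ) := by
  classical
  induction t using Finset.induction_on generalizing s with
  | empty =>
    obtain ⟨r, hr⟩ := exists_finrank_iSup_inf c s
    refine ⟨∑ i ∈ range (z - r), X ^ i, ?_⟩
    intro k _ _ V _ _ _ A B Z hA hB hc hZ hz
    have hD : (s.sup fun e => A e.1 ⊓ B e.2) ≤ Z :=
      Finset.sup_le fun e _ => inf_le_left.trans (hZ _)
    have := ncard_isHyperplane hD
    rw [hr k V A B hA hB hc, hz] at this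
    simp only [Finset.sup_le_iff] at this
    simp only [Finset.notMem_empty, IsEmpty.forall_iff, implies_true, and_true,
      and_comm (a := IsHyperplane _ _), this, eval_finsetSum, eval_pow, eval_X]
    push_cast
    rfl
  | insert e t _ ih =>
    obtain ⟨P, hP⟩ := ih s
    obtain ⟨Q, hQ⟩ := ih (insert e s)
    refine ⟨P - Q, ?_⟩
    intro k _ _ V _ _ _ A B Z hA hB hc hZ hz
    have : Finite V := Module.finite_of_finite k
    rw [eval_sub, ← hP k V A B Z hA hB hc hZ hz, ← hQ k V A B Z hA hB hc hZ hz, eq_sub_iff_add_eq]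
    norm_cast
    rw [← Set.ncard_union_eq]
    · congr 1
      ext H
      simp only [Set.mem_union, Set.mem_ofPred_eq, Finset.forall_mem_insert]
      tauto
    · rw [Set.disjoint_left]
      intro H h h'
      exact h.2.2 e (Finset.mem_insert_self _ _) (h'.2.1 e (Finset.mem_insert_self _ _))

end Count

section Peel

/-- The rank function of the indecomposable representation supported on `a + 1, …, b`. -/
def segRank (a b i j : ℕ) : ℕ := if a < i ∧ j ≤ b then 1 else 0

variable {k : Type*} [Field k] {V : ℕ → Type*} [∀ i, AddCommGroup (V i)] [∀ i, Module k (V i)]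
  {φ : ∀ i : ℕ, V i →ₗ[k] V (i + 1)} {a b : ℕ} {Z Y : ∀ i, Submodule k (V i)}
  {H : Submodule k (V b)}

variable (φ a b Z H) in
/-- The graded subspace of `Z` cut out by a hyperplane `H` of `Z b` at the vertices
`a + 1, …, b`. -/
def peel (i : ℕ) : Submodule k (V i) :=
  if a < i ∧ i ≤ b then Z i ⊓ H.comap (transition φ i b) else Z i

variable (φ a b Z H) in
/-- The hyperplanes `H` of `Z b` for which `Z / peel φ a b Z H` is the indecomposable
representation supported on `a + 1, …, b`. -/
def IsPeelable : Prop :=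
  IsHyperplane H (Z b) ∧ (Z a).map (transition φ a b) ≤ H ∧
    ¬ (Z (a + 1)).map (transition φ (a + 1) b) ≤ H

theorem peel_of_mem {i : ℕ} (hi : a < i) (hib : i ≤ b) :
    peel φ a b Z H i = Z i ⊓ H.comap (transition φ i b) :=
  if_pos ⟨hi, hib⟩

theorem peel_of_notMem {i : ℕ} (hi : ¬ (a < i ∧ i ≤ b)) : peel φ a b Z H i = Z i :=
  if_neg hi

theorem peel_le : peel φ a b Z H ≤ Z := by
  intro i
  unfold peel
  split_ifs
  · exact inf_le_left
  · exact le_rfl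

theorem peel_top (hab : a < b) (hH : H ≤ Z b) : peel φ a b Z H b = H := by
  rw [peel_of_mem hab le_rfl, transition_self, Submodule.comap_id, inf_eq_right.mpr hH]

theorem IsSubrep.map_transition_le (hZ : IsSubrep φ Z) {i j l : ℕ} (hij : i ≤ j) (hjl : j ≤ l) :
    (Z i).map (transition φ i l) ≤ (Z j).map (transition φ j l) := by
  rw [← transition_comp φ hij hjl, Submodule.map_comp]
  exact Submodule.map_mono (hZ i j hij)

theorem IsPeelable.not_map_le (hH : IsPeelable φ a b Z H) (hZ : IsSubrep φ Z) {i : ℕ}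
    (hi : a < i) (hib : i ≤ b) : ¬ (Z i).map (transition φ i b) ≤ H :=
  fun h => hH.2.2 ((hZ.map_transition_le hi hib).trans h)

theorem IsSubrep.peel (hZ : IsSubrep φ Z) (hab : a < b)
    (hH : (Z a).map (transition φ a b) ≤ H) : IsSubrep φ (peel φ a b Z H) := by
  intro i j hij
  have hle : (_root_.peel φ a b Z H i).map (transition φ i j) ≤ Z j :=
    (Submodule.map_mono (peel_le i)).trans (hZ i j hij)
  by_cases hj : a < j ∧ j ≤ b
  · rw [peel_of_mem hj.1 hj.2]
    refine le_inf hle ?_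
    rw [← Submodule.map_le_iff_le_comap, ← Submodule.map_comp, transition_comp φ hij hj.2]
    by_cases hi : a < i
    · rw [peel_of_mem hi (hij.trans hj.2), Submodule.map_le_iff_le_comap]
      exact inf_le_right
    · rw [peel_of_notMem fun h => hi h.1]
      exact (hZ.map_transition_le (not_lt.mp hi) hab.le).trans hH
  · rwa [peel_of_notMem hj]

variable (φ b Z) in
/-- The flag of images in `Z b`. -/
def imageFlag (i : ℕ) : Submodule k (V b) := (Z (min i b)).map (transition φ (min i b) b)

variable (φ b) in
/-- The flag of kernels in `V b`. -/
def kerFlag (j : ℕ) : Submodule k (V b) := ker (transition φ b (max j b))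

theorem IsSubrep.monotone_imageFlag (hZ : IsSubrep φ Z) : Monotone (imageFlag φ b Z) :=
  fun _ _ h => hZ.map_transition_le (min_le_min_right _ h) (min_le_right _ _)

theorem monotone_kerFlag : Monotone (kerFlag φ b) := by
  intro i j h
  rw [kerFlag, kerFlag, ← transition_comp φ (le_max_right i b) (max_le_max_right b h)]
  exact ker_le_ker_comp _ _

theorem IsSubrep.imageFlag_le (hZ : IsSubrep φ Z) (i : ℕ) : imageFlag φ b Z i ≤ Z b :=
  hZ _ _ (min_le_right _ _)

theorem imageFlag_inf_kerFlag {i j : ℕ} (hi : i ≤ b) (hj : b ≤ j) :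
    imageFlag φ b Z i ⊓ kerFlag φ b j
      = (Z i ⊓ ker (transition φ i j)).map (transition φ i b) := by
  rw [imageFlag, kerFlag, max_eq_left hj, min_eq_left hi, Submodule.map_inf_eq_map_inf_comap,
    ← ker_comp, transition_comp φ hi hj]

variable [∀ i, FiniteDimensional k (V i)]

theorem IsPeelable.isHyperplane (hH : IsPeelable φ a b Z H) (hZ : IsSubrep φ Z) {i : ℕ}
    (hi : a < i) (hib : i ≤ b) : IsHyperplane (peel φ a b Z H i) (Z i) := by
  rw [peel_of_mem hi hib]
  exact hH.1.inf_comap (hZ i b hib) (hH.not_map_le hZ hi hib)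

theorem IsPeelable.hasRank (hH : IsPeelable φ a b Z H) (hZ : IsSubrep φ Z) (hab : a < b) :
    HasRank φ Z (peel φ a b Z H) (segRank a b) := by
  intro i j hij
  have hY := hZ.peel hab hH.2.1
  by_cases h : a < i ∧ j ≤ b
  · have hYj := hH.isHyperplane hZ (h.1.trans_le hij) h.2
    rw [hYj.sup_eq (hZ i j hij), segRank, if_pos h, ← hYj.2, add_comm]
    intro hle
    apply hH.not_map_le hZ h.1 (hij.trans h.2)
    rw [← transition_comp φ hij h.2, Submodule.map_comp]
    refine (Submodule.map_mono hle).trans ?_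
    rw [peel_of_mem (h.1.trans_le hij) h.2, Submodule.map_le_iff_le_comap]
    exact inf_le_right
  · rw [segRank, if_neg h, zero_add, sup_eq_right.mpr]
    by_cases hi : a < i ∧ i ≤ b
    · rw [peel_of_notMem fun hj => h ⟨hi.1, hj.2⟩]
      exact hZ i j hij
    · rw [← peel_of_notMem (φ := φ) (Z := Z) (H := H) hi]
      exact hY i j hij

theorem isPeelable_of_hasRank (hab : a < b) (hYZ : Y ≤ Z)
    (h : HasRank φ Z Y (segRank a b)) : IsPeelable φ a b Z (Y b) := by
  refine ⟨⟨hYZ b, ?_⟩, ?_, ?_⟩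
  · rw [h.finrank_eq hYZ, segRank, if_pos ⟨hab, le_rfl⟩, add_comm]
  · have := h a b hab.le
    rw [segRank, if_neg (by simp), zero_add] at this
    exact sup_eq_right.mp (Submodule.eq_of_le_of_finrank_eq le_sup_right this.symm).symm
  · intro hle
    have := h (a + 1) b hab
    rw [segRank, if_pos ⟨by simp, le_rfl⟩, sup_eq_right.mpr hle] at this
    omega

theorem eq_peel_of_hasRank (hab : a < b) (hZ : IsSubrep φ Z) (hY : IsSubrep φ Y) (hYZ : Y ≤ Z)
    (h : HasRank φ Z Y (segRank a b)) : Y = peel φ a b Z (Y b) := by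
  have hH := isPeelable_of_hasRank hab hYZ h
  funext i
  have hi := h.finrank_eq hYZ i
  rw [segRank] at hi
  split_ifs at hi with hai
  · apply Submodule.eq_of_le_of_finrank_eq
    · rw [peel_of_mem hai.1 hai.2]
      exact le_inf (hYZ i) (Submodule.map_le_iff_le_comap.mp (hY i b hai.2))
    · have := (hH.isHyperplane hZ hai.1 hai.2).2
      omega
  · rw [peel_of_notMem hai]
    exact Submodule.eq_of_le_of_finrank_eq (hYZ i) (by omega)

theorem bijOn_peel (hab : a < b) (hZ : IsSubrep φ Z) :
    Set.BijOn (fun Y : ∀ i, Submodule k (V i) => Y b)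
      {Y | Y ≤ Z ∧ IsSubrep φ Y ∧ HasRank φ Z Y (segRank a b)} {H | IsPeelable φ a b Z H} := by
  refine ⟨fun Y hY => isPeelable_of_hasRank hab hY.1 hY.2.2, ?_, ?_⟩
  · intro Y hY Y' hY' h
    rw [eq_peel_of_hasRank hab hZ hY.2.1 hY.1 hY.2.2,
      eq_peel_of_hasRank hab hZ hY'.2.1 hY'.1 hY'.2.2]
    simp only at h
    rw [h]
  · intro H hH
    exact ⟨peel φ a b Z H, ⟨peel_le, hZ.peel hab hH.2.1, hH.hasRank hZ hab⟩, peel_top hab hH.1.1⟩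

theorem HasRank.finrank_imageFlag_inf_kerFlag {R : ℕ → ℕ → ℕ} (hR : HasRank φ Z ⊥ R) (i j : ℕ) :
    finrank k ↥(imageFlag φ b Z i ⊓ kerFlag φ b j)
      = R (min i b) b - R (min i b) (max j b) := by
  rw [hasRank_bot_iff] at hR
  have h := Submodule.finrank_map_add_finrank_inf_ker (imageFlag φ b Z i)
    (transition φ b (max j b))
  rw [imageFlag, ← Submodule.map_comp, transition_comp φ (min_le_right i b) (le_max_right j b),
    hR _ _ ((min_le_right i b).trans (le_max_right j b)), hR _ _ (min_le_right i b)] at h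
  rw [imageFlag, kerFlag]
  omega

/-- The rank function of `peel φ a b Z H` when `Z` has rank function `R` and `H` contains exactly
the intersections of the image and kernel flags indexed by `s`. -/
def cutRank (a b : ℕ) (s : Finset (ℕ × ℕ)) (R : ℕ → ℕ → ℕ) (i j : ℕ) : ℕ :=
  if (a < i ∧ i ≤ b) ∧ (j ≤ b ∨ (i, j) ∈ s) then R i j - 1 else R i j

theorem IsPeelable.hasRank_bot (hH : IsPeelable φ a b Z H) (hZ : IsSubrep φ Z)
    {R : ℕ → ℕ → ℕ} (hR : HasRank φ Z ⊥ R) {s : Finset (ℕ × ℕ)}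
    (hs : ∀ i j, a < i → i ≤ b → b < j →
      ((i, j) ∈ s ↔ imageFlag φ b Z i ⊓ kerFlag φ b j ≤ H)) :
    HasRank φ (peel φ a b Z H) ⊥ (cutRank a b s R) := by
  rw [hasRank_bot_iff] at hR ⊢
  intro i j hij
  rw [cutRank]
  by_cases hi : a < i ∧ i ≤ b
  · have hY := hH.isHyperplane hZ hi.1 hi.2
    have key : (j ≤ b ∨ (i, j) ∈ s) ↔ Z i ⊓ ker (transition φ i j) ≤ peel φ a b Z H i := by
      rw [peel_of_mem hi.1 hi.2]
      rcases le_or_gt j b with hj | hj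
      · simp only [hj, true_or, true_iff]
        refine inf_le_inf_left _ ?_
        rw [← transition_comp φ hij hj]
        exact (ker_le_ker_comp _ _).trans (Submodule.comap_mono bot_le)
      · rw [hs i j hi.1 hi.2 hj, imageFlag_inf_kerFlag hi.2 hj.le, Submodule.map_le_iff_le_comap,
          le_inf_iff, and_iff_right inf_le_left, or_iff_right (not_le.mpr hj)]
    split_ifs with h
    · rw [hY.finrank_map_of_le (key.mp h.2), hR i j hij]
    · rw [hY.map_eq_of_not_le fun h' => h ⟨hi, key.mpr h'⟩, hR i j hij]
  · rw [if_neg fun h => hi h.1, peel_of_notMem hi, hR i j hij]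

end Peel

section Subquotient

variable {k : Type*} [Field k] {V : ℕ → Type*} [∀ i, AddCommGroup (V i)] [∀ i, Module k (V i)]
  [∀ i, FiniteDimensional k (V i)] {φ : ∀ i : ℕ, V i →ₗ[k] V (i + 1)}
  {A B W Y Z : ∀ i, Submodule k (V i)} {R R₁ : ℕ → ℕ → ℕ} {a b : ℕ}

theorem HasRank.sup_eq (h : HasRank φ A B R) (hA : IsSubrep φ A) (hBA : B ≤ A) {i j : ℕ}
    (hij : i ≤ j) (hR : R i j = R j j) : (A i).map (transition φ i j) ⊔ B j = A j := by
  apply Submodule.eq_of_le_of_finrank_eq (sup_le (hA i j hij) (hBA j))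
  rw [h i j hij, hR, h.finrank_eq hBA]

/-- An extension of the indecomposable supported on `a + 1, …, b` by a representation without
segments starting after `a + 1` is split. -/
theorem HasRank.trans_segRank (hZY : HasRank φ Z Y (segRank a b)) (hYW : HasRank φ Y W R₁)
    (hZ : IsSubrep φ Z) (hY : IsSubrep φ Y) (hle : Y ≤ Z) (hWY : W ≤ Y)
    (hR : ∀ i j, i ≤ j → R i j = R₁ i j + segRank a b i j)
    (hR₁ : ∀ i j, a < i → i ≤ j → R₁ i j = R₁ j j) : HasRank φ Z W R := by
  intro i j hij
  by_cases hi : a < i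
  · have hseg : segRank a b i j = segRank a b j j := by
      simp [segRank, hi, hi.trans_le hij]
    have h : (Z i).map (transition φ i j) ⊔ W j = Z j := by
      apply le_antisymm (sup_le (hZ i j hij) ((hWY j).trans (hle j)))
      rw [← hZY.sup_eq hZ hle hij hseg, ← hYW.sup_eq hY hWY hij (hR₁ i j hi hij)]
      exact sup_le le_sup_left
        (sup_le ((Submodule.map_mono (hle i)).trans le_sup_left) le_sup_right)
    rw [h, hZY.finrank_eq hle, hYW.finrank_eq hWY, hR i j hij, hseg, hR₁ i j hi hij]
    ring
  · have h := hZY.finrank_eq hle i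
    rw [segRank, if_neg fun h => hi h.1, zero_add] at h
    rw [← Submodule.eq_of_le_of_finrank_eq (hle i) h.symm, hYW i j hij, hR i j hij, segRank,
      if_neg fun h => hi h.1, add_zero]

theorem HasRank.peel (hZW : HasRank φ Z W R) (hZ : IsSubrep φ Z)
    (hWZ : W ≤ Z) (hab : a < b) {H : Submodule k (V b)} (hH : IsPeelable φ a b Z H)
    (hWH : W ≤ peel φ a b Z H)
    (hR : ∀ i j, i ≤ j → R i j = R₁ i j + segRank a b i j)
    (hR₁ : ∀ i j, a < i → i ≤ j → R₁ i j = R₁ j j) (hR₂ : ∀ j, b < j → R₁ a j = R₁ j j) :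
    HasRank φ (peel φ a b Z H) W R₁ := by
  intro i j hij
  have hY := hZ.peel hab hH.2.1
  by_cases hi : a < i ∧ i ≤ b
  · have hseg : segRank a b i j = segRank a b j j := by
      simp [segRank, hi.1, hi.1.trans_le hij]
    have hsup := hZW.sup_eq hZ hWZ hij
      (by rw [hR i j hij, hR j j le_rfl, hseg, hR₁ i j hi.1 hij])
    have h : (_root_.peel φ a b Z H i).map (transition φ i j) ⊔ W j = _root_.peel φ a b Z H j := by
      apply le_antisymm (sup_le (hY i j hij) (hWH j))
      rcases le_or_gt j b with hj | hj
      · have haj := hi.1.trans_le hij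
        have hWj := hWH j
        rw [peel_of_mem haj hj] at hWj ⊢
        rintro y ⟨hyZ, hyH⟩
        rw [← hsup] at hyZ
        obtain ⟨x, ⟨z, hz, rfl⟩, w, hw, rfl⟩ := Submodule.mem_sup.mp hyZ
        refine Submodule.add_mem_sup ⟨z, ?_, rfl⟩ hw
        rw [peel_of_mem hi.1 hi.2]
        refine ⟨hz, ?_⟩
        rw [SetLike.mem_coe, Submodule.mem_comap, map_add, transition_apply φ hij hj] at hyH
        exact (Submodule.add_mem_iff_left H (hWj hw).2).mp hyH
      · have haj := (hab.trans hj).le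
        have ha := hZW.sup_eq hZ hWZ haj (by
          rw [hR a j haj, hR j j le_rfl, hR₂ j hj]
          simp [segRank, hj])
        rw [peel_of_notMem fun h => absurd h.2 (not_le.mpr hj), ← ha]
        refine sup_le_sup_right ?_ _
        rw [← peel_of_notMem (φ := φ) (b := b) (Z := Z) (H := H) fun h => absurd h.1 (lt_irrefl a)]
        exact hY.map_transition_le hi.1.le hij
    rw [h, hR₁ i j hi.1 hij]
    have h1 := hZW.finrank_eq hWZ j
    have h2 := (hH.hasRank hZ hab).finrank_eq peel_le j
    have h3 := hR j j le_rfl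
    omega
  · rw [peel_of_notMem hi, hZW i j hij, hR i j hij, segRank,
      if_neg fun h => hi ⟨h.1, hij.trans h.2⟩, add_zero]

theorem HasRank.ncard_peel [Finite k] (hZW : HasRank φ Z W R) (hZ : IsSubrep φ Z)
    (hW : IsSubrep φ W) (hWZ : W ≤ Z) (hab : a < b)
    (hR : ∀ i j, i ≤ j → R i j = R₁ i j + segRank a b i j)
    (hR₁ : ∀ i j, a < i → i ≤ j → R₁ i j = R₁ j j) (hR₂ : ∀ j, b < j → R₁ a j = R₁ j j)
    {c : ℕ} (hc : R b b = R a b + c) :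
    {Y : ∀ i, Submodule k (V i) | (Y ≤ Z ∧ IsSubrep φ Y ∧ HasRank φ Z Y (segRank a b)) ∧
      W ≤ Y ∧ HasRank φ Y W R₁}.ncard = ∑ i ∈ range c, Nat.card k ^ i := by
  have hD : (Z a).map (transition φ a b) ⊔ W b ≤ Z b := sup_le (hZ a b hab.le) (hWZ b)
  have hdim : finrank k (Z b) - finrank k ↥((Z a).map (transition φ a b) ⊔ W b) = c := by
    rw [hZW a b hab.le, hZW.finrank_eq hWZ]
    omega
  rw [← hdim, ← ncard_isHyperplane hD]
  have hbij := bijOn_peel (k := k) (φ := φ) hab hZ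
  refine Set.BijOn.ncard_eq (f := fun Y : ∀ i, Submodule k (V i) => Y b)
    ⟨?_, hbij.injOn.mono fun Y hY => hY.1, ?_⟩
  · intro Y hY
    have hH : IsPeelable φ a b Z (Y b) := hbij.mapsTo hY.1
    exact ⟨sup_le hH.2.1 (hY.2.1 b), hH.1⟩
  · rintro H ⟨hDH, hH⟩
    have hpeel : IsPeelable φ a b Z H := by
      refine ⟨hH, le_sup_left.trans hDH, fun hle => ?_⟩
      have hsup := hZW.sup_eq hZ hWZ (i := a + 1) (j := b) hab (by
        rw [hR _ _ hab, hR b b le_rfl, hR₁ _ _ (Nat.lt_succ_self a) hab]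
        simp [segRank, hab])
      have := Submodule.finrank_mono (hsup ▸ sup_le hle (le_sup_right.trans hDH) : Z b ≤ H)
      have := hH.2
      omega
    have hWH : W ≤ _root_.peel φ a b Z H := by
      intro i
      by_cases hi : a < i ∧ i ≤ b
      · rw [peel_of_mem hi.1 hi.2]
        exact le_inf (hWZ i) (Submodule.map_le_iff_le_comap.mp
          ((hW i b hi.2).trans (le_sup_right.trans hDH)))
      · rw [peel_of_notMem hi]
        exact hWZ i
    exact ⟨_root_.peel φ a b Z H, ⟨⟨peel_le, hZ.peel hab hpeel.2.1, hpeel.hasRank hZ hab⟩, hWH,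
      hZW.peel hZ hWZ hab hpeel hWH hR hR₁ hR₂⟩, peel_top hab hH.1⟩

end Subquotient

section Sum

open Polynomial

theorem ncard_setOf_eq_card_filter {α : Type*} [Fintype α] (p : α → Prop) [DecidablePred p] :
    {x | p x}.ncard = #{x | p x} := by
  rw [← Set.ncard_coe_finset]
  simp

open Classical in
theorem exists_polynomial_sum_peel (n a b : ℕ) (hab : a < b) (hbn : b ≤ n) (R : ℕ → ℕ → ℕ)
    (Q : (ℕ → ℕ → ℕ) → ℤ[X]) :
    ∃ P : ℤ[X], ∀ (k : Type) [Field k] [Finite k] (V : ℕ → Type) [∀ i, AddCommGroup (V i)]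
      [∀ i, Module k (V i)] [∀ i, FiniteDimensional k (V i)]
      [Fintype (∀ i, Submodule k (V i))] (φ : ∀ i : ℕ, V i →ₗ[k] V (i + 1))
      (Z : ∀ i, Submodule k (V i)) (F : (∀ i, Submodule k (V i)) → ℤ),
      (∀ i, n < i → Subsingleton (V i)) → IsSubrep φ Z → HasRank φ Z ⊥ R →
      (∀ Y ≤ Z, ∀ R', IsSubrep φ Y → HasRank φ Y ⊥ R' → F Y = (Q R').eval (Nat.card k : ℤ)) →
      ∑ Y with Y ≤ Z ∧ IsSubrep φ Y ∧ HasRank φ Z Y (segRank a b), F Y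
        = P.eval (Nat.card k : ℤ) := by
  choose N hN using exists_polynomial_ncard_isHyperplane
    (fun i j => R (min i b) b - R (min i b) (max j b)) (R b b)
  let E : Finset (ℕ × ℕ) := Finset.range (b + 1) ×ˢ Finset.range (n + 2)
  let T : Finset (Finset (ℕ × ℕ)) := {s ∈ E.powerset | (a, n + 1) ∈ s ∧ (a + 1, n + 1) ∉ s}
  refine ⟨∑ s ∈ T, N s (E \ s) * Q (cutRank a b s R), ?_⟩
  intro k _ _ V _ _ _ _ φ Z F hV hZ hR hF
  have : Finite (V b) := Module.finite_of_finite k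
  have : Fintype (Submodule k (V b)) := Fintype.ofFinite _
  let D : ℕ × ℕ → Submodule k (V b) := fun e => imageFlag φ b Z e.1 ⊓ kerFlag φ b e.2
  let S : Submodule k (V b) → Finset (ℕ × ℕ) := fun H => {e ∈ E | D e ≤ H}
  have hD : ∀ i j, i ≤ b → n < j → D (i, j) = (Z i).map (transition φ i b) := by
    intro i j hi hj
    have := hV j hj
    have hker : ker (transition φ i j) = ⊤ := eq_top_iff.mpr fun x _ => Subsingleton.elim _ _
    simp only [D]
    rw [imageFlag_inf_kerFlag hi (hbn.trans hj.le), hker, inf_top_eq]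
  have hST : ∀ H, IsPeelable φ a b Z H ↔ IsHyperplane H (Z b) ∧ S H ∈ T := by
    intro H
    simp only [IsPeelable, T, S, E, mem_filter, mem_powerset, filter_subset, true_and, mem_product,
      Finset.mem_range]
    rw [hD a (n + 1) hab.le (Nat.lt_succ_self n), hD (a + 1) (n + 1) hab (Nat.lt_succ_self n)]
    have h1 : a < b + 1 := by omega
    have h2 : a + 1 < b + 1 := by omega
    simp [h1, h2]
  have hsum : ∑ Y with Y ≤ Z ∧ IsSubrep φ Y ∧ HasRank φ Z Y (segRank a b), F Y
      = ∑ H with IsPeelable φ a b Z H, (Q (cutRank a b (S H) R)).eval (Nat.card k : ℤ) := by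
    have hbij := bijOn_peel (k := k) (φ := φ) hab hZ
    refine Finset.sum_bij (fun Y _ => Y b) ?_ ?_ ?_ ?_
    · intro Y hY
      rw [mem_filter_univ] at hY ⊢
      exact hbij.mapsTo hY
    · intro Y hY Y' hY' h
      rw [mem_filter_univ] at hY hY'
      exact hbij.injOn hY hY' h
    · intro H hH
      rw [mem_filter_univ] at hH
      obtain ⟨Y, hY, rfl⟩ := hbij.surjOn hH
      exact ⟨Y, by rwa [mem_filter_univ], rfl⟩
    · intro Y hY
      rw [mem_filter_univ] at hY
      have hH : IsPeelable φ a b Z (Y b) := hbij.mapsTo hY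
      refine hF Y hY.1 _ hY.2.1 ?_
      conv in HasRank _ _ _ => rw [eq_peel_of_hasRank hab hZ hY.2.1 hY.1 hY.2.2]
      refine hH.hasRank_bot hZ hR ?_
      intro i j hi hib hj
      simp only [S, E, mem_filter, mem_product, Finset.mem_range, D]
      refine and_iff_right_of_imp fun h => ⟨by omega, ?_⟩
      by_contra hjn
      have := hD i j hib (by omega)
      simp only [D] at this
      rw [this] at h
      exact hH.not_map_le hZ hi hib h
  have hmap : ∀ H ∈ ({H | IsPeelable φ a b Z H} : Finset (Submodule k (V b))), S H ∈ T := by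
    intro H hH
    rw [mem_filter_univ] at hH
    exact ((hST H).mp hH).2
  rw [hsum, ← Finset.sum_fiberwise_of_maps_to' hmap
    fun s => (Q (cutRank a b s R)).eval (Nat.card k : ℤ), eval_finsetSum]
  refine Finset.sum_congr rfl fun s hs => ?_
  rw [Finset.sum_const, eval_mul, nsmul_eq_mul]
  congr 1
  rw [← hN s (E \ s) k (V b) (imageFlag φ b Z) (kerFlag φ b) (Z b) hZ.monotone_imageFlag
    monotone_kerFlag (fun i j => hR.finrank_imageFlag_inf_kerFlag i j) hZ.imageFlag_le
    ((hR.finrank_eq bot_le b).trans (by simp)), ncard_setOf_eq_card_filter, filter_filter]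
  congr 2
  ext H
  simp only [mem_filter, mem_univ, true_and, hST]
  have hsE : s ⊆ E := mem_powerset.mp (mem_filter.mp hs).1
  constructor
  · rintro ⟨⟨hH, -⟩, rfl⟩
    refine ⟨hH, fun e he => (mem_filter.mp he).2, fun e he h => ?_⟩
    rw [mem_sdiff] at he
    exact he.2 (mem_filter.mpr ⟨he.1, h⟩)
  · rintro ⟨hH, h1, h2⟩
    have : S H = s := by
      ext e
      simp only [S, mem_filter]
      refine ⟨fun he => ?_, fun he => ⟨hsE he, h1 e he⟩⟩
      by_contra hes
      exact h2 e (mem_sdiff.mpr ⟨he.1, hes⟩) he.2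
    exact ⟨⟨hH, this ▸ hs⟩, this⟩

end Sum

section Multisegment

/-- The rank function of a multisegment: the number of segments containing `i` and `j`. -/
def msRank (n : ℕ) (m : ℕ → ℕ → ℕ) (i j : ℕ) : ℕ := ∑ a ∈ Icc 1 i, ∑ b ∈ Icc j n, m a b

variable {n : ℕ} {m : ℕ → ℕ → ℕ}

theorem msRank_eq_of_forall {i i' j : ℕ} (hi : i ≤ i')
    (h : ∀ x, i < x → x ≤ i' → ∀ y, j ≤ y → y ≤ n → m x y = 0) :
    msRank n m i j = msRank n m i' j := by
  refine Finset.sum_subset (Icc_subset_Icc_right hi) fun x hx hx' => ?_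
  rw [mem_Icc] at hx hx'
  refine Finset.sum_eq_zero fun y hy => ?_
  rw [mem_Icc] at hy
  exact h x (by omega) hx.2 y hy.1 hy.2

theorem sum_Icc_single {n a b i j : ℕ} (hbn : b ≤ n) :
    ∑ x ∈ Icc 1 i, ∑ y ∈ Icc j n, (if x = a + 1 ∧ y = b then 1 else 0)
      = if a < i ∧ j ≤ b then 1 else 0 := by
  have h : ∀ x y : ℕ, (if x = a + 1 ∧ y = b then 1 else 0)
      = if x = a + 1 then if y = b then 1 else 0 else 0 := fun x y => by
    split_ifs <;> simp_all
  simp_rw [h, Finset.sum_ite_irrel, Finset.sum_const_zero, Finset.sum_ite_eq', mem_Icc, hbn,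
    and_true, Nat.succ_le_iff, Nat.zero_lt_succ, true_and]
  split_ifs <;> simp_all

end Multisegment

section Main

open Polynomial

theorem finite_subreps {k : Type} [Field k] [Finite k] {V : ℕ → Type} [∀ i, AddCommGroup (V i)]
    [∀ i, Module k (V i)] [∀ i, FiniteDimensional k (V i)] {n : ℕ}
    (hV : ∀ i, n < i → Subsingleton (V i)) : Finite (∀ i, Submodule k (V i)) := by
  have : ∀ i, Finite (V i) := fun i => Module.finite_of_finite k
  refine Finite.of_injective
    (fun (W : ∀ i, Submodule k (V i)) (i : Fin (n + 1)) => W i) fun W W' h => ?_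
  funext i
  rcases le_or_gt i n with hi | hi
  · exact congrFun h ⟨i, Nat.lt_succ_of_le hi⟩
  · have := hV i hi
    exact Subsingleton.elim _ _

/-- If `m = m₁ + [a + 1, b]` and no segment of `m` is lexicographically larger than `[a + 1, b]`,
the Hall numbers with quotient of type `m` are determined by those with quotient of
type `m₁`. -/
theorem ncard_mul_eq_sum {k : Type} [Field k] [Finite k] {V : ℕ → Type}
    [∀ i, AddCommGroup (V i)] [∀ i, Module k (V i)] [∀ i, FiniteDimensional k (V i)]
    [Fintype (∀ i, Submodule k (V i))] {φ : ∀ i : ℕ, V i →ₗ[k] V (i + 1)}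
    {Z : ∀ i, Submodule k (V i)} {R R₁ R' : ℕ → ℕ → ℕ} {a b c : ℕ} (hZ : IsSubrep φ Z)
    (hab : a < b) (hR : ∀ i j, i ≤ j → R i j = R₁ i j + segRank a b i j)
    (hR₁ : ∀ i j, a < i → i ≤ j → R₁ i j = R₁ j j) (hR₂ : ∀ j, b < j → R₁ a j = R₁ j j)
    (hc : R b b = R a b + c) :
    {W | W ≤ Z ∧ IsSubrep φ W ∧ HasRank φ W ⊥ R' ∧ HasRank φ Z W R}.ncard
        * ∑ i ∈ Finset.range c, Nat.card k ^ i
      = open Classical in ∑ Y with Y ≤ Z ∧ IsSubrep φ Y ∧ HasRank φ Z Y (segRank a b),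
        {W | W ≤ Y ∧ IsSubrep φ W ∧ HasRank φ W ⊥ R' ∧ HasRank φ Y W R₁}.ncard := by
  classical
  have h := Finset.sum_card_bipartiteAbove_eq_sum_card_bipartiteBelow
    (s := {W | W ≤ Z ∧ IsSubrep φ W ∧ HasRank φ W ⊥ R' ∧ HasRank φ Z W R})
    (t := {Y | Y ≤ Z ∧ IsSubrep φ Y ∧ HasRank φ Z Y (segRank a b)})
    (fun W Y : ∀ i, Submodule k (V i) => W ≤ Y ∧ HasRank φ Y W R₁)
  rw [ncard_setOf_eq_card_filter, ← smul_eq_mul, ← Finset.sum_const]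
  refine Eq.trans (Finset.sum_congr rfl fun W hW => ?_)
    (h.trans (Finset.sum_congr rfl fun Y hY => ?_))
  · rw [mem_filter_univ] at hW
    rw [← hW.2.2.2.ncard_peel hZ hW.2.1 hW.1 hab hR hR₁ hR₂ hc, ncard_setOf_eq_card_filter,
      bipartiteAbove, filter_filter]
  · rw [mem_filter_univ] at hY
    rw [ncard_setOf_eq_card_filter, bipartiteBelow, filter_filter]
    congr 1
    ext W
    rw [mem_filter_univ, mem_filter_univ]
    constructor
    · rintro ⟨⟨-, hW, hW', -⟩, hWY, hYW⟩
      exact ⟨hWY, hW, hW', hYW⟩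
    · rintro ⟨hWY, hW, hW', hYW⟩
      exact ⟨⟨hWY.trans hY.1, hW, hW',
        hY.2.2.trans_segRank hYW hZ hY.2.1 hY.1 hWY hR hR₁⟩, hWY, hYW⟩

theorem exists_polynomial_ncard_mul (n N : ℕ) : ∀ m : ℕ → ℕ → ℕ,
    ∑ p ∈ Icc 1 n ×ˢ Icc 1 n with p.1 ≤ p.2, m p.1 p.2 = N →
    ∃ g : ℤ[X], g.Monic ∧ (∀ q : ℕ, 0 < q → 0 < g.eval (q : ℤ)) ∧
      ∀ R R' : ℕ → ℕ → ℕ, ∃ Q : ℤ[X],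
        ∀ (k : Type) [Field k] [Finite k] (V : ℕ → Type) [∀ i, AddCommGroup (V i)]
          [∀ i, Module k (V i)] [∀ i, FiniteDimensional k (V i)]
          (φ : ∀ i : ℕ, V i →ₗ[k] V (i + 1)) (Z : ∀ i, Submodule k (V i)),
          (∀ i, n < i → Subsingleton (V i)) → IsSubrep φ Z → HasRank φ Z ⊥ R →
          ({W | W ≤ Z ∧ IsSubrep φ W ∧ HasRank φ W ⊥ R' ∧ HasRank φ Z W (msRank n m)}.ncard : ℤ)
            * g.eval (Nat.card k : ℤ) = Q.eval (Nat.card k : ℤ) := by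
  classical
  induction N with
  | zero =>
    intro m hm
    refine ⟨1, monic_one, by simp, fun R R' => ?_⟩
    have hm0 : ∀ i j, i ≤ j → msRank n m i j = 0 := by
      intro i j hij
      refine Finset.sum_eq_zero fun x hx => Finset.sum_eq_zero fun y hy => ?_
      rw [Finset.sum_eq_zero_iff] at hm
      rw [mem_Icc] at hx hy
      exact hm (x, y) (by simp only [mem_filter, mem_product, mem_Icc]; omega)
    refine ⟨if ∀ i j, i ≤ j → R i j = R' i j then 1 else 0, ?_⟩
    intro k _ _ V _ _ _ φ Z hV hZ hR
    have key : ∀ W, (W ≤ Z ∧ IsSubrep φ W ∧ HasRank φ W ⊥ R' ∧ HasRank φ Z W (msRank n m)) ↔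
        W = Z ∧ ∀ i j, i ≤ j → R i j = R' i j := by
      intro W
      constructor
      · rintro ⟨hWZ, hW, hR', h⟩
        obtain rfl : W = Z := funext fun i => Submodule.eq_of_le_of_finrank_eq (hWZ i) (by
          rw [h.finrank_eq hWZ, hm0 i i le_rfl, zero_add])
        rw [hasRank_bot_iff] at hR hR'
        exact ⟨rfl, fun i j hij => (hR i j hij).symm.trans (hR' i j hij)⟩
      · rintro ⟨rfl, h⟩
        refine ⟨le_rfl, hZ, fun i j hij => ?_, fun i j hij => ?_⟩
        · rw [hR i j hij, h i j hij]
        · rw [hm0 i j hij, zero_add, sup_eq_right.mpr (hZ i j hij)]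
    simp only [key]
    split_ifs with h
    · have hset : {W | W = Z ∧ ∀ i j, i ≤ j → R i j = R' i j} = {Z} :=
        Set.ext fun W => and_iff_left h
      rw [hset, Set.ncard_singleton]
      simp
    · simp [h]
  | succ N ih =>
    intro m hm
    obtain ⟨p, hp, hmax⟩ := ({p ∈ Icc 1 n ×ˢ Icc 1 n | p.1 ≤ p.2 ∧ m p.1 p.2 ≠ 0}).exists_max_image
      toLex (by
        by_contra hemp
        rw [Finset.not_nonempty_iff_eq_empty, filter_eq_empty_iff] at hemp
        rw [Finset.sum_eq_zero fun p hp => ?_] at hm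
        · omega
        · rw [mem_filter] at hp
          by_contra h
          exact hemp hp.1 ⟨hp.2, h⟩)
    obtain ⟨a', b⟩ := p
    simp only [mem_filter, mem_product, mem_Icc] at hp hmax
    obtain ⟨⟨⟨ha1, -⟩, -, hbn⟩, hab', hmab⟩ := hp
    obtain ⟨a, rfl⟩ := Nat.exists_eq_add_of_le' ha1
    have hab : a < b := hab'
    have hzero : ∀ x y, x ≤ y → y ≤ n → (a + 1 < x ∨ x = a + 1 ∧ b < y) → m x y = 0 := by
      intro x y hxy hyn hx
      by_contra h
      have := hmax (x, y) ⟨⟨⟨by omega, by omega⟩, by omega, hyn⟩, hxy, h⟩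
      rw [Prod.Lex.toLex_le_toLex] at this
      simp only at this
      omega
    set m₁ : ℕ → ℕ → ℕ := fun x y => m x y - if x = a + 1 ∧ y = b then 1 else 0 with hm₁
    have hm_eq : ∀ x y, m x y = m₁ x y + if x = a + 1 ∧ y = b then 1 else 0 := by
      intro x y
      simp only [hm₁]
      split_ifs with h
      · obtain ⟨rfl, rfl⟩ := h
        omega
      · rfl
    have hzero₁ : ∀ x y, x ≤ y → y ≤ n → (a + 1 < x ∨ x = a + 1 ∧ b < y) → m₁ x y = 0 := by
      intro x y hxy hyn hx
      have := hm_eq x y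
      rw [hzero x y hxy hyn hx] at this
      omega
    have hR : ∀ i j, i ≤ j → msRank n m i j = msRank n m₁ i j + segRank a b i j := by
      intro i j _
      simp only [msRank, hm_eq, Finset.sum_add_distrib, segRank, sum_Icc_single hbn]
    have hR₁ : ∀ i j, a < i → i ≤ j → msRank n m₁ i j = msRank n m₁ j j := by
      intro i j hi hij
      exact msRank_eq_of_forall hij fun x hx hxj y hy hyn =>
        hzero₁ x y (by omega) hyn (by omega)
    have hR₂ : ∀ j, b < j → msRank n m₁ a j = msRank n m₁ j j := by
      intro j hj
      exact msRank_eq_of_forall (by omega) fun x hx hxj y hy hyn =>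
        hzero₁ x y (by omega) hyn (by omega)
    have hc : msRank n m b b = msRank n m a b + m (a + 1) b := by
      rw [← msRank_eq_of_forall (i := a + 1) hab fun x hx hxj y hy hyn =>
        hzero x y (by omega) hyn (by omega), msRank, Finset.sum_Icc_succ_top (by omega), msRank,
        Finset.sum_eq_single (s := Icc b n) b]
      · intro y hy hyb
        rw [mem_Icc] at hy
        exact hzero _ y (by omega) hy.2 (by omega)
      · intro h
        exact absurd (mem_Icc.mpr ⟨le_rfl, hbn⟩) h
    have hN : ∑ p ∈ Icc 1 n ×ˢ Icc 1 n with p.1 ≤ p.2, m₁ p.1 p.2 = N := by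
      simp only [hm_eq, Finset.sum_add_distrib] at hm
      rw [Finset.sum_eq_single (f := fun p : ℕ × ℕ => if p.1 = a + 1 ∧ p.2 = b then 1 else 0)
        (a + 1, b)] at hm
      · simpa using hm
      · rintro ⟨x, y⟩ _ h
        exact if_neg fun h' => h (Prod.ext h'.1 h'.2)
      · intro h
        refine absurd ?_ h
        simp only [mem_filter, mem_product, mem_Icc]
        omega
    obtain ⟨g, hg, hgpos, hQ⟩ := ih m₁ hN
    refine ⟨g * ∑ i ∈ Finset.range (m (a + 1) b), X ^ i, hg.mul (monic_geom_sum_X hmab), ?_, ?_⟩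
    · intro q hq
      rw [eval_mul, eval_geom_sum]
      refine mul_pos (hgpos q hq) (Finset.sum_pos (fun i _ => by positivity) ?_)
      rwa [Finset.nonempty_range_iff]
    · intro R R'
      choose Q hQ using fun R => hQ R R'
      obtain ⟨P, hP⟩ := exists_polynomial_sum_peel n a b hab hbn R Q
      refine ⟨P, ?_⟩
      intro k _ _ V _ _ _ φ Z hV hZ hRZ
      have := finite_subreps (k := k) hV
      have : Fintype (∀ i, Submodule k (V i)) := Fintype.ofFinite _
      rw [← hP k V φ Z (fun Y => ({W | W ≤ Y ∧ IsSubrep φ W ∧ HasRank φ W ⊥ R' ∧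
        HasRank φ Y W (msRank n m₁)}.ncard : ℤ) * g.eval (Nat.card k : ℤ)) hV hZ hRZ
        fun Y _ R₀ hY hYR => hQ R₀ k V φ Y hV hY hYR, ← Finset.sum_mul]
      have := ncard_mul_eq_sum (R' := R') hZ hab hR hR₁ hR₂ hc
      rw [eval_mul, eval_geom_sum, mul_comm (g.eval _), ← mul_assoc]
      congr 1
      exact_mod_cast this

theorem Polynomial.dvd_of_infinite_eval_dvd {g Q : ℤ[X]} (hg : g.Monic)
    (h : {q : ℕ | g.eval (q : ℤ) ∣ Q.eval (q : ℤ)}.Infinite) : g ∣ Q := by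
  rw [← modByMonic_eq_zero_iff_dvd hg]
  set r := Q %ₘ g with hr
  have hdeg : (r.map (Int.castRingHom ℝ)).degree < (g.map (Int.castRingHom ℝ)).degree := by
    rw [degree_map_eq_of_injective Int.cast_injective,
      degree_map_eq_of_injective Int.cast_injective]
    exact degree_modByMonic_lt Q hg
  have hlim := (div_tendsto_atTop_zero_of_degree_lt _ _ hdeg).comp tendsto_natCast_atTop_atTop
  have hev : ∀ᶠ q : ℕ in Filter.atTop, |((r.eval (q : ℤ) : ℤ) : ℝ) / (g.eval (q : ℤ) : ℤ)| < 1 := by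
    have := hlim.abs.eventually_lt_const (u := 1) (by simp)
    filter_upwards [this] with q hq
    have hcast : ∀ f : ℤ[X], (f.map (Int.castRingHom ℝ)).eval (q : ℝ) = (f.eval (q : ℤ) : ℤ) :=
      fun f => by simp
    simpa [hcast] using hq
  obtain ⟨q₀, hq₀⟩ := Filter.eventually_atTop.mp hev
  have hinf : ({q : ℕ | g.eval (q : ℤ) ∣ Q.eval (q : ℤ)} \ Set.Iio q₀).Infinite :=
    h.sdiff (Set.finite_Iio q₀)
  refine eq_zero_of_infinite_isRoot r
    ((hinf.image (f := ((↑) : ℕ → ℤ)) Nat.cast_injective.injOn).mono ?_)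
  rintro _ ⟨q, ⟨hq, hq'⟩, rfl⟩
  have hq1 := hq₀ q (not_lt.mp hq')
  have hdvd : g.eval (q : ℤ) ∣ r.eval (q : ℤ) := by
    have : r = Q - g * (Q /ₘ g) := by rw [hr, modByMonic_eq_sub_mul_div]
    rw [this, eval_sub, eval_mul]
    exact dvd_sub hq (dvd_mul_right _ _)
  by_contra hne
  have hle := Int.natAbs_le_of_dvd_ne_zero hdvd hne
  have hg0 : g.eval (q : ℤ) ≠ 0 := fun h0 => hne (zero_dvd_iff.mp (h0 ▸ hdvd))
  rw [abs_div, div_lt_one (by positivity)] at hq1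
  have : |r.eval (q : ℤ)| < |g.eval (q : ℤ)| := by exact_mod_cast hq1
  rw [Int.abs_eq_natAbs, Int.abs_eq_natAbs] at this
  omega

end Main

section Segments

/-- The segments (with multiplicity) of a multisegment containing the vertices `i` and `j`. -/
def segments (n : ℕ) (m : ℕ → ℕ → ℕ) (i j : ℕ) : Finset (Σ _ : ℕ × ℕ, ℕ) :=
  (Icc 1 i ×ˢ Icc j n).sigma fun p => Finset.range (m p.1 p.2)

theorem segments_inter (n : ℕ) (m : ℕ → ℕ → ℕ) {i j : ℕ} (hij : i ≤ j) :
    segments n m i i ∩ segments n m j j = segments n m i j := by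
  ext e
  simp only [segments, mem_inter, mem_sigma, mem_product, mem_Icc]
  grind

theorem card_segments (n : ℕ) (m : ℕ → ℕ → ℕ) (i j : ℕ) :
    #(segments n m i j) = msRank n m i j := by
  simp [segments, card_sigma, Finset.sum_product, msRank]

theorem subsingleton_segments_fun {k : Type*} (n : ℕ) (m : ℕ → ℕ → ℕ) {i : ℕ} (hi : n < i) :
    Subsingleton (segments n m i i → k) := by
  have : segments n m i i = ∅ := by
    rw [← card_eq_zero, card_segments, msRank, Icc_eq_empty (not_le.mpr hi)]
    simp
  rw [this]
  infer_instance

end Segments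

section Realization

variable {k : Type*} [Field k] {α : Type*} [DecidableEq α]

/-- Restriction of functions on `S` to `S ∩ T`, followed by extension by zero to `T`. -/
def restrictExtend (k : Type*) [Field k] (S T : Finset α) : (S → k) →ₗ[k] (T → k) where
  toFun x e := if h : e.1 ∈ S then x ⟨e.1, h⟩ else 0
  map_add' x y := by
    ext e
    by_cases h : e.1 ∈ S <;> simp [h]
  map_smul' c x := by
    ext e
    by_cases h : e.1 ∈ S <;> simp [h]

theorem restrictExtend_comp {S T U : Finset α} (h : S ∩ U ⊆ T) :
    (restrictExtend k T U).comp (restrictExtend k S T) = restrictExtend k S U := by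
  refine LinearMap.ext fun x => funext fun e => ?_
  have := @h e.1
  by_cases hT : e.1 ∈ T <;> by_cases hS : e.1 ∈ S <;> simp_all [restrictExtend]

theorem restrictExtend_self (S : Finset α) : restrictExtend k S S = LinearMap.id := by
  refine LinearMap.ext fun x => funext fun e => ?_
  simp [restrictExtend]

theorem finrank_range_restrictExtend (S T : Finset α) :
    finrank k (LinearMap.range (restrictExtend k S T)) = #(S ∩ T) := by
  have hsurj : Function.Surjective (restrictExtend k S (S ∩ T)) := fun x =>
    ⟨restrictExtend k (S ∩ T) S x, by
      rw [← comp_apply, restrictExtend_comp (by simp), restrictExtend_self, id_apply]⟩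
  have hinj : Function.Injective (restrictExtend k (S ∩ T) T) :=
    Function.LeftInverse.injective (g := restrictExtend k T (S ∩ T)) fun x => by
      rw [← comp_apply, restrictExtend_comp (by simp), restrictExtend_self, id_apply]
  rw [← restrictExtend_comp (T := S ∩ T) le_rfl,
    range_comp_of_range_eq_top _ (range_eq_top.mpr hsurj), finrank_range_of_inj hinj]
  simp

/-- The structure maps of the standard representation of type `m`. -/
def standardRep (k : Type*) [Field k] (n : ℕ) (m : ℕ → ℕ → ℕ) (i : ℕ) :
    (segments n m i i → k) →ₗ[k] (segments n m (i + 1) (i + 1) → k) :=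
  restrictExtend k _ _

theorem transition_standardRep (n : ℕ) (m : ℕ → ℕ → ℕ) {i j : ℕ} (hij : i ≤ j) :
    transition (standardRep k n m) i j
      = restrictExtend k (segments n m i i) (segments n m j j) := by
  induction j, hij using Nat.le_induction with
  | base => rw [transition_self, restrictExtend_self]
  | succ j hj ih =>
    rw [transition_succ _ hj, ih, standardRep, restrictExtend_comp]
    rw [segments_inter n m (hj.trans (Nat.le_succ j))]
    intro e
    simp only [segments, mem_sigma, mem_product, mem_Icc]
    grind

theorem hasRank_standardRep (n : ℕ) (m : ℕ → ℕ → ℕ) :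
    HasRank (standardRep k n m) ⊤ ⊥ (msRank n m) := by
  rw [hasRank_bot_iff]
  intro i j hij
  rw [transition_standardRep n m hij, Pi.top_apply, Submodule.map_top,
    finrank_range_restrictExtend, segments_inter n m hij, card_segments]

end Realization

section HasTypeA

variable {k : Type*} [Field k] {V : ℕ → Type*} [∀ i, AddCommGroup (V i)] [∀ i, Module k (V i)]
  {φ : ∀ i : ℕ, V i →ₗ[k] V (i + 1)} {n : ℕ} {m : ℕ → ℕ → ℕ} {W : ∀ i, Submodule k (V i)}

theorem hasRank_iff_comps {A B : ∀ i, Submodule k (V i)} {R : ℕ → ℕ → ℕ} :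
    HasRank φ A B R ↔ ∀ i t, finrank k ↥((A i).map (comps φ i t) ⊔ B (i + t))
      = R i (i + t) + finrank k (B (i + t)) := by
  constructor
  · intro h i t
    rw [comps_eq_transition]
    exact h i (i + t) (Nat.le_add_right i t)
  · intro h i j hij
    obtain ⟨t, rfl⟩ := Nat.exists_eq_add_of_le hij
    rw [← comps_eq_transition]
    exact h i t

variable [∀ i, FiniteDimensional k (V i)]

theorem hasTypeA_iff_finrank_range_comps :
    HasTypeA k n m φ ↔
      ∀ i t, finrank k (LinearMap.range (comps φ i t)) = msRank n m i (i + t) := by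
  constructor
  · rintro ⟨hdim, hrank⟩ i t
    rcases t with _ | t
    · rw [comps, range_id, finrank_top]
      exact hdim i
    rcases Nat.eq_zero_or_pos i with rfl | hi
    · have h0 : finrank k (V 0) = 0 := by simp [hdim, dimOf]
      have := (comps φ 0 (t + 1)).finrank_range_le
      rw [h0] at this
      rw [Nat.le_zero.mp this]
      simp [msRank]
    rcases le_or_gt (i + (t + 1)) n with hn | hn
    · have := hrank i (i + t) hi (Nat.le_add_right i t) (by omega)
      rwa [Nat.add_sub_cancel_left] at this
    · have h0 : finrank k (V (i + (t + 1))) = 0 := by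
        simp [hdim, dimOf, Icc_eq_empty (not_le.mpr hn)]
      have := Submodule.finrank_le (LinearMap.range (comps φ i (t + 1)))
      rw [h0] at this
      rw [msRank, Icc_eq_empty (not_le.mpr hn)]
      simpa using this
  · intro h
    refine ⟨fun i => ?_, fun i j hi hij hj => ?_⟩
    · have := h i 0
      rwa [comps, range_id, finrank_top] at this
    · obtain ⟨t, rfl⟩ := Nat.exists_eq_add_of_le hij
      rw [Nat.add_sub_cancel_left]
      exact h i (t + 1)

theorem hasTypeA_iff_hasRank : HasTypeA k n m φ ↔ HasRank φ ⊤ ⊥ (msRank n m) := by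
  rw [hasTypeA_iff_finrank_range_comps, hasRank_iff_comps]
  refine forall₂_congr fun i t => ?_
  rw [Pi.top_apply, Submodule.map_top, show (⊥ : ∀ i, Submodule k (V i)) (i + t) = ⊥ from rfl,
    sup_bot_eq, finrank_bot, add_zero]

theorem hasTypeA_restrict_iff (hW : ∀ i, ∀ v ∈ W i, φ i v ∈ W (i + 1)) :
    HasTypeA k n m (fun i => (φ i).restrict (hW i)) ↔ HasRank φ W ⊥ (msRank n m) := by
  rw [hasTypeA_iff_finrank_range_comps, hasRank_iff_comps]
  have hcomp : ∀ i t, (W (i + t)).subtype.comp (comps (fun i => (φ i).restrict (hW i)) i t)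
      = (comps φ i t).comp (W i).subtype := by
    intro i t
    induction t with
    | zero => rfl
    | succ t ih =>
      ext x
      exact congrArg (φ (i + t)) (LinearMap.congr_fun ih x)
  refine forall₂_congr fun i t => ?_
  rw [show (⊥ : ∀ i, Submodule k (V i)) (i + t) = ⊥ from rfl, sup_bot_eq, finrank_bot, add_zero,
    ← Submodule.finrank_map_subtype_eq, ← range_comp, hcomp, range_comp, Submodule.range_subtype]

theorem hasTypeA_mapQ_iff (hW : ∀ i, W i ≤ (W (i + 1)).comap (φ i)) :
    HasTypeA k n m (fun i => (W i).mapQ (W (i + 1)) (φ i) (hW i))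
      ↔ HasRank φ ⊤ W (msRank n m) := by
  rw [hasTypeA_iff_finrank_range_comps, hasRank_iff_comps]
  have hcomp : ∀ i t, (comps (fun i => (W i).mapQ (W (i + 1)) (φ i) (hW i)) i t).comp (W i).mkQ
      = (W (i + t)).mkQ.comp (comps φ i t) := by
    intro i t
    induction t with
    | zero => rfl
    | succ t ih =>
      ext x
      exact congrArg ((W (i + t)).mapQ (W (i + t + 1)) (φ (i + t)) (hW (i + t)))
        (LinearMap.congr_fun ih x)
  refine forall₂_congr fun i t => ?_
  rw [← range_comp_of_range_eq_top _ (Submodule.range_mkQ (W i)), hcomp, range_comp,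
    Pi.top_apply, Submodule.map_top]
  have h := Submodule.finrank_map_add_finrank_inf_ker
    (LinearMap.range (comps φ i t) ⊔ W (i + t)) (W (i + t)).mkQ
  rw [Submodule.ker_mkQ, inf_eq_right.mpr le_sup_right, Submodule.map_sup,
    Submodule.mkQ_map_self, sup_bot_eq] at h
  omega

end HasTypeA

/-- Existence of Hall polynomials for the equioriented quiver `Δ_n`: given
multisegments `m, m′, m″` with dimension vectors satisfying `d = d′ + d″`,
there is a polynomial `P ∈ ℤ[T]` such that for every finite field `k` with
`q` elements and every representation `φ ∈ E(d)` of type `m`, the number of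
graded `φ`-invariant subspaces `W` such that the subrepresentation has type
`m′` and the quotient representation has type `m″` equals `P(q)`. -/
theorem hall_polynomials_exist_type_A
    (n : ℕ) (hn : 1 ≤ n) (m m' m'' : ℕ → ℕ → ℕ)
    (hdim : ∀ i, dimOf n m i = dimOf n m' i + dimOf n m'' i) :
    ∃ P : Polynomial ℤ,
      ∀ (k : Type) [Field k] [Fintype k]
        (φ : ∀ i : ℕ, (Fin (dimOf n m i) → k) →ₗ[k] (Fin (dimOf n m (i + 1)) → k)),
        HasTypeA k n m φ →
        (Set.ncard {W : ∀ i : ℕ, Submodule k (Fin (dimOf n m i) → k) |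
            ∃ hW : ∀ i, W i ≤ (W (i + 1)).comap (φ i),
              HasTypeA k n m' (fun i => (φ i).restrict fun v hv => hW i hv) ∧
              HasTypeA k n m''
                (fun i => (W i).mapQ (W (i + 1)) (φ i) (hW i))} : ℤ)
          = P.eval (Fintype.card k : ℤ) := by
  obtain ⟨g, hg, hgpos, hQ⟩ := exists_polynomial_ncard_mul n _ m'' rfl
  obtain ⟨Q, hQ⟩ := hQ (msRank n m) (msRank n m')
  have htop : ∀ {k : Type} [Field k] {V : ℕ → Type} [∀ i, AddCommGroup (V i)]
      [∀ i, Module k (V i)] (φ : ∀ i : ℕ, V i →ₗ[k] V (i + 1)), IsSubrep φ ⊤ :=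
    fun φ i j _ => le_top
  have hdvd : g ∣ Q := by
    refine Polynomial.dvd_of_infinite_eval_dvd hg (Nat.infinite_setOfPred_prime.mono fun p hp => ?_)
    have : Fact p.Prime := ⟨hp⟩
    have h := hQ (ZMod p) _ (standardRep (ZMod p) n m) ⊤
      (fun i hi => subsingleton_segments_fun n m hi) (htop _) (hasRank_standardRep n m)
    rw [Nat.card_zmod] at h
    exact Dvd.intro_left _ h
  obtain ⟨P, rfl⟩ := hdvd
  refine ⟨P, fun k _ _ φ hφ => ?_⟩
  have hV : ∀ i, n < i → Subsingleton (Fin (dimOf n m i) → k) := by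
    intro i hi
    have : dimOf n m i = 0 := by simp [dimOf, Icc_eq_empty (not_le.mpr hi)]
    rw [this]
    infer_instance
  have h := hQ k _ φ ⊤ hV (htop φ) (hasTypeA_iff_hasRank.mp hφ)
  rw [Polynomial.eval_mul, mul_comm, Nat.card_eq_fintype_card] at h
  rw [← mul_left_cancel₀ (hgpos _ Fintype.card_pos).ne' h]
  congr 2
  ext W
  simp only [Set.mem_ofPred_eq, le_top, true_and, isSubrep_iff]
  constructor
  · rintro ⟨hW, h', h''⟩
    exact ⟨hW, (hasTypeA_restrict_iff fun i v hv => hW i hv).mp h',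
      (hasTypeA_mapQ_iff hW).mp h''⟩
  · rintro ⟨hW, h', h''⟩
    exact ⟨hW, (hasTypeA_restrict_iff fun i v hv => hW i hv).mpr h',
      (hasTypeA_mapQ_iff hW).mpr h''⟩
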